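/- Let G be a finite simple graph with a non-identity automorphism, and let α be a non-identity automorphism of G for which c(α) is maximal among all non-identity automorphisms of G. Then the order of α is a prime number p, and every cycle of α (every orbit of the subgroup generated by α on V(G)) has size either p or 1. -/

import Mathlib

/-- The number of cycles of a permutation, counting fixed points as cycles: the number of
orbits on `V` of the cyclic subgroup generated by the permutation. -/
noncomputable def cycleCount {V : Type*} (σ : Equiv.Perm V) : ℕ :=
  Nat.card (MulAction.orbitRel.Quotient (Subgroup.zpowers σ) V)

open MulAction in
/-- If a subgroup has at most as many orbits as a smaller one, then the orbits coincide. -/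
theorem MulAction.orbit_eq_of_le_of_card_quotient_le {Γ V : Type*} [Group Γ] [MulAction Γ V]
    [Finite V] {H K : Subgroup Γ} (hHK : H ≤ K)
    (hcard : Nat.card (orbitRel.Quotient H V) ≤ Nat.card (orbitRel.Quotient K V)) (v : V) :
    orbit H v = orbit K v := by
  have hle : ∀ a b : V, orbitRel H V a b → orbitRel K V a b := by
    rintro a b ⟨g, hg⟩
    exact ⟨⟨g, hHK g.2⟩, hg⟩
  let f : orbitRel.Quotient H V → orbitRel.Quotient K V := Quotient.map id hle
  have hf : Function.Surjective f := fun q ↦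
    Quotient.inductionOn q fun a ↦ ⟨Quotient.mk _ a, rfl⟩
  have : Finite (orbitRel.Quotient H V) := Quotient.finite _
  have : Finite (orbitRel.Quotient K V) := Quotient.finite _
  have hinj : Function.Injective f := (hf.bijective_of_nat_card_le hcard).1
  ext w
  refine ⟨hle w v, fun hw ↦ ?_⟩
  have hq : f (Quotient.mk _ w) = f (Quotient.mk _ v) := Quotient.sound hw
  exact Quotient.exact (hinj hq)

theorem SimpleGraph.Iso.toEquiv_pow {V : Type*} {G : SimpleGraph V} (α : G ≃g G) (k : ℕ) :
    (α ^ k).toEquiv = (α.toEquiv ^ k : Equiv.Perm V) := by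
  induction k with
  | zero => rfl
  | succ k ih => rw [pow_succ, pow_succ, ← ih]; rfl

/-- A non-identity automorphism with the maximal number of cycles has prime order `p`,
and each of its cycles (orbits of the generated cyclic subgroup) has size `p` or `1`. -/
theorem maxCycleCount_automorphism_prime_order {V : Type*} [Fintype V] (G : SimpleGraph V)
    (α : G ≃g G) (hα : α.toEquiv ≠ Equiv.refl V)
    (hmax : ∀ β : G ≃g G, β.toEquiv ≠ Equiv.refl V →
      cycleCount β.toEquiv ≤ cycleCount α.toEquiv) :
    ∃ p : ℕ, p.Prime ∧ orderOf α.toEquiv = p ∧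
      ∀ v : V, Nat.card (MulAction.orbit (Subgroup.zpowers α.toEquiv) v) = p ∨
        Nat.card (MulAction.orbit (Subgroup.zpowers α.toEquiv) v) = 1 := by
  classical
  let σ : Equiv.Perm V := α.toEquiv
  have hσ : orderOf σ ≠ 1 := fun h ↦ hα (orderOf_eq_one_iff.1 h)
  obtain ⟨p, hp, hdvd⟩ := Nat.exists_prime_and_dvd hσ
  have hτ : orderOf (σ ^ (orderOf σ / p)) = p :=
    orderOf_pow_orderOf_div (orderOf_pos σ).ne' hdvd
  have hτ1 : σ ^ (orderOf σ / p) ≠ 1 := by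
    intro h
    rw [h, orderOf_one] at hτ
    exact hp.one_lt.ne hτ
  have hcount : cycleCount (σ ^ (orderOf σ / p)) ≤ cycleCount σ := by
    have h := hmax (α ^ (orderOf σ / p))
    rw [SimpleGraph.Iso.toEquiv_pow] at h
    exact h hτ1
  have horbit := MulAction.orbit_eq_of_le_of_card_quotient_le
    (Subgroup.zpowers_le.2 (Subgroup.npow_mem_zpowers σ (orderOf σ / p))) hcount
  have hsize (v : V) : Nat.card (MulAction.orbit (Subgroup.zpowers σ) v) ∣ p := by
    rw [← horbit v, Nat.card_congr (MulAction.orbitEquivQuotientStabilizer _ v)]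
    refine (Subgroup.card_quotient_dvd_card _).trans ?_
    rw [Nat.card_zpowers, hτ]
  refine ⟨p, hp, ?_, fun v ↦ ((Nat.dvd_prime hp).1 (hsize v)).symm⟩
  have : Fact p.Prime := ⟨hp⟩
  have hpow : σ ^ p = 1 := by
    ext v
    change σ ^ p • v = v
    rw [MulAction.pow_smul_eq_iff_minimalPeriod_dvd, MulAction.minimalPeriod_eq_card,
      ← Nat.card_eq_fintype_card]
    exact hsize v
  exact orderOf_eq_prime hpow fun h ↦ hα h
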